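/- Binary splitting is sound: let R be a 2-track AFT with states Q = {q₁,…,q_l}, initial formula I and final formula F, let R₁ have initial formula I and final formula ⋀_{i=1}^{l}(q_i → t_i), and R₂ have initial formula ⋀_{i=1}^{l}(t_i → q_i) and final formula F, both over fresh parameters t̄ = t₁,…,t_l and otherwise identical to R. Then the constraint x = R(u ∘ v) is equivalent to ∃x₁ x₂ t̄. (x = x₁ ∘ x₂ ∧ x₁ = R₁(u)[t̄] ∧ x₂ = R₂(v)[t̄]). In words: R accepts (x, u∘v) iff there exists a split x = x₁∘x₂ and a parameter assignment such that R₁ accepts (x₁,u) and R₂ accepts (x₂,v) with that assignment. -/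

import Mathlib

/-- Boolean formulae over variables of type `α`. -/
inductive BF (α : Type) : Type where
  | var : α → BF α
  | tru : BF α
  | fls : BF α
  | and : BF α → BF α → BF α
  | or  : BF α → BF α → BF α
  | not : BF α → BF α

namespace BF

variable {α β : Type}

/-- Evaluation of a Boolean formula under an assignment. -/
def eval (A : α → Bool) : BF α → Bool
  | var v => A v
  | tru => true
  | fls => false
  | and f g => f.eval A && g.eval A
  | or f g => f.eval A || g.eval A
  | not f => ! f.eval A

/-- `PolarOn P b φ` holds iff every occurrence of a variable satisfying `P`
is under an even number of negations when `b = true`, resp. an odd number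
of negations when `b = false`. -/
def PolarOn (P : α → Prop) : Bool → BF α → Prop
  | b, var v => P v → b = true
  | _, tru => True
  | _, fls => True
  | b, and f g => PolarOn P b f ∧ PolarOn P b g
  | b, or f g => PolarOn P b f ∧ PolarOn P b g
  | b, not f => PolarOn P (!b) f

/-- A formula is positive if every variable occurs under an even number of negations. -/
def Positive (φ : BF α) : Prop := PolarOn (fun _ => True) true φ

/-- A formula is negative if every variable occurs under an odd number of negations. -/
def Negative (φ : BF α) : Prop := PolarOn (fun _ => True) false φ

/-- Renaming of variables. -/
def map (f : α → β) : BF α → BF β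
  | var v => var (f v)
  | tru => tru
  | fls => fls
  | and g h => and (g.map f) (h.map f)
  | or g h => or (g.map f) (h.map f)
  | not g => not (g.map f)

/-- The set of variables occurring in a formula. -/
def varSet : BF α → Set α
  | var v => {v}
  | tru => ∅
  | fls => ∅
  | and f g => f.varSet ∪ g.varSet
  | or f g => f.varSet ∪ g.varSet
  | not f => f.varSet

/-- Finite conjunction. -/
def bigAnd (l : List (BF α)) : BF α := l.foldr and tru

/-- Finite disjunction. -/
def bigOr (l : List (BF α)) : BF α := l.foldr or fls

/-- Biconditional. -/
def iff (f g : BF α) : BF α := (f.and g).or (f.not.and g.not)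

end BF

/-- A succinct alternating finite automaton over input bit variables `ι` and
states `Q`: the transition function assigns to each state a Boolean formula
over input variables and states, and there are an initial and a final formula
over states. -/
structure AFA (ι Q : Type) where
  delta : Q → BF (ι ⊕ Q)
  init : BF Q
  final : BF Q

namespace AFA

variable {ι Q Q' : Type}

/-- Well-formedness of a succinct AFA: transition formulae are positive on
states, the initial formula is positive, and the final formula is negative. -/
def WF (M : AFA ι Q) : Prop :=
  (∀ q, BF.PolarOn (fun x => ∃ p, x = Sum.inr p) true (M.delta q)) ∧
    M.init.Positive ∧ M.final.Negative

/-- One step of a run: every state active in `α` has its transition formula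
satisfied by the input letter `b` together with the successor configuration `α'`. -/
def Step (M : AFA ι Q) (α : Q → Bool) (b : ι → Bool) (α' : Q → Bool) : Prop :=
  ∀ q, α q = true → (M.delta q).eval (Sum.elim b α') = true

/-- A run of the AFA over the word `w`, given by its sequence of configurations. -/
def IsRun (M : AFA ι Q) (w : List (ι → Bool)) (αs : Fin (w.length + 1) → Q → Bool) : Prop :=
  ∀ i : Fin w.length, M.Step (αs i.castSucc) (w.get i) (αs i.succ)

/-- Acceptance: there is a run whose first configuration satisfies the initial
formula and whose last configuration satisfies the final formula. -/
def Accepts (M : AFA ι Q) (w : List (ι → Bool)) : Prop :=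
  ∃ αs : Fin (w.length + 1) → Q → Bool,
    M.IsRun w αs ∧ M.init.eval (αs 0) = true ∧
      M.final.eval (αs (Fin.last w.length)) = true

/-- The language of an AFA. -/
def Lang (M : AFA ι Q) : Set (List (ι → Bool)) := {w | M.Accepts w}

/-- Product (intersection) construction on AFAs with disjoint state sets. -/
def inter (M : AFA ι Q) (M' : AFA ι Q') : AFA ι (Q ⊕ Q') where
  delta := fun q => match q with
    | .inl q => (M.delta q).map (Sum.map id Sum.inl)
    | .inr q => (M'.delta q).map (Sum.map id Sum.inr)
  init := (M.init.map Sum.inl).and (M'.init.map Sum.inr)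
  final := (M.final.map Sum.inl).and (M'.final.map Sum.inr)

/-- Union construction on AFAs with disjoint state sets. -/
def union (M : AFA ι Q) (M' : AFA ι Q') : AFA ι (Q ⊕ Q') where
  delta := fun q => match q with
    | .inl q => (M.delta q).map (Sum.map id Sum.inl)
    | .inr q => (M'.delta q).map (Sum.map id Sum.inr)
  init := (M.init.map Sum.inl).or (M'.init.map Sum.inr)
  final := (M.final.map Sum.inl).and (M'.final.map Sum.inr)

end AFA
/-- A `k`-track letter over value bit variables `V` and epsilon bit variables `E`
is an assignment to the indexed bit variables `(V ⊕ E) × Fin k`.  The word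
carried by track `i` is obtained by erasing all positions in which some epsilon
bit of track `i` is set, and restricting the remaining letters to the value
bits of track `i`. -/
def trackWord {V E : Type} [Fintype E] {k : ℕ}
    (w : List ((V ⊕ E) × Fin k → Bool)) (i : Fin k) : List (V → Bool) :=
  (w.filter fun b => ! decide (∃ e : E, b (Sum.inr e, i) = true)).map
    fun b v => b (Sum.inl v, i)

/-- A `k`-track AFT `M` (an AFA over `(V ⊕ E) × Fin k`) recognises the tuple of
words `t` iff it accepts some word whose track projections are exactly `t`. -/
def AFA.RelAccepts {V E : Type} [Fintype E] {k : ℕ} {Q : Type}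
    (M : AFA ((V ⊕ E) × Fin k) Q) (t : Fin k → List (V → Bool)) : Prop :=
  ∃ w, M.Accepts w ∧ ∀ i, trackWord w i = t i

/-- A succinct alternating automaton/transducer with synchronisation parameters
`P`: the initial and final formulae may mention parameters (positively and
negatively) besides states. -/
structure PAFA (ι P Q : Type) where
  delta : Q → BF (ι ⊕ Q)
  init : BF (P ⊕ Q)
  final : BF (P ⊕ Q)

namespace PAFA

variable {ι P Q : Type}

/-- Well-formedness: transitions positive on states, the initial formula
positive on states, the final formula negative on states (parameters may occur
with both polarities). -/
def WF (M : PAFA ι P Q) : Prop :=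
  (∀ q, BF.PolarOn (fun x => ∃ p, x = Sum.inr p) true (M.delta q)) ∧
    BF.PolarOn (fun x => ∃ q, x = Sum.inr q) true M.init ∧
    BF.PolarOn (fun x => ∃ q, x = Sum.inr q) false M.final

/-- Acceptance of a word with a given parameter assignment `π`. -/
def AcceptsWith (M : PAFA ι P Q) (π : P → Bool) (w : List (ι → Bool)) : Prop :=
  ∃ αs : Fin (w.length + 1) → Q → Bool,
    (∀ i : Fin w.length, ∀ q, αs i.castSucc q = true →
        (M.delta q).eval (Sum.elim (w.get i) (αs i.succ)) = true) ∧
    M.init.eval (Sum.elim π (αs 0)) = true ∧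
    M.final.eval (Sum.elim π (αs (Fin.last w.length))) = true

/-- A `k`-track AFT with parameters recognises the tuple `t` with parameter
assignment `π` iff it accepts with `π` some word whose track projections are `t`. -/
def RelAcceptsWith {V E : Type} [Fintype E] {k : ℕ}
    (M : PAFA ((V ⊕ E) × Fin k) P Q) (π : P → Bool)
    (t : Fin k → List (V → Bool)) : Prop :=
  ∃ w, M.AcceptsWith π w ∧ ∀ i, trackWord w i = t i

end PAFA

/-- The first half of the binary splitting of a 2-track AFT `R` with states
`q₁,…,q_l`: same transitions, same initial formula `I` (lifted over the fresh
parameters `t̄`), and final formula `⋀_i (q_i → t_i)`. -/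
def split1 {ι : Type} {l : ℕ} (R : AFA ι (Fin l)) : PAFA ι (Fin l) (Fin l) where
  delta := R.delta
  init := R.init.map Sum.inr
  final := BF.bigAnd ((List.finRange l).map fun i =>
    ((BF.var (Sum.inr i)).not).or (BF.var (Sum.inl i)))

/-- The second half of the binary splitting of a 2-track AFT `R`: same
transitions, initial formula `⋀_i (t_i → q_i)`, and the final formula `F` of `R`. -/
def split2 {ι : Type} {l : ℕ} (R : AFA ι (Fin l)) : PAFA ι (Fin l) (Fin l) where
  delta := R.delta
  init := BF.bigAnd ((List.finRange l).map fun i =>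
    ((BF.var (Sum.inl i)).not).or (BF.var (Sum.inr i)))
  final := R.final.map Sum.inr

namespace BSplit

theorem eval_map {α β : Type} (f : α → β) (A : β → Bool) (φ : BF α) :
    (φ.map f).eval A = φ.eval (fun a => A (f a)) := by
  induction φ <;> simp_all [BF.map, BF.eval]

theorem eval_bigAnd {α : Type} (A : α → Bool) (L : List (BF α)) :
    (BF.bigAnd L).eval A = true ↔ ∀ φ ∈ L, φ.eval A = true := by
  induction L with
  | nil => simp [BF.bigAnd, BF.eval]
  | cons a L ih =>
    have h : BF.bigAnd (a :: L) = BF.and a (BF.bigAnd L) := rfl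
    rw [h]
    simp [BF.eval, ih]

theorem eval_mono {α : Type} (A B : α → Bool) (h : ∀ a, A a = true → B a = true) (φ : BF α) :
    (BF.PolarOn (fun _ => True) true φ → φ.eval A = true → φ.eval B = true) ∧
    (BF.PolarOn (fun _ => True) false φ → φ.eval B = true → φ.eval A = true) := by
  induction φ with
  | var v => simp [BF.PolarOn, BF.eval]; exact h v
  | tru => simp [BF.eval]
  | fls => simp [BF.eval]
  | and f g hf hg => simp only [BF.PolarOn, BF.eval, Bool.and_eq_true]; tauto
  | or f g hf hg => simp only [BF.PolarOn, BF.eval, Bool.or_eq_true]; tauto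
  | not f hf =>
    simp only [BF.PolarOn, BF.eval, Bool.not_true, Bool.not_false, Bool.not_eq_true']
    refine ⟨fun hp ha => ?_, fun hp ha => ?_⟩
    · have := hf.2 hp
      by_contra hc
      simp_all
    · have := hf.1 hp
      by_contra hc
      simp_all

/-- Reachability along a word. -/
def Reach {ι Q : Type} (S : (Q → Bool) → (ι → Bool) → (Q → Bool) → Prop) :
    List (ι → Bool) → (Q → Bool) → (Q → Bool) → Prop
  | [], a, c => a = c
  | b :: w, a, c => ∃ d, S a b d ∧ Reach S w d c

theorem reach_iff {ι Q : Type} (S : (Q → Bool) → (ι → Bool) → (Q → Bool) → Prop)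
    (w : List (ι → Bool)) (a c : Q → Bool) :
    Reach S w a c ↔ ∃ αs : Fin (w.length + 1) → Q → Bool,
      (∀ i : Fin w.length, S (αs i.castSucc) (w.get i) (αs i.succ)) ∧ αs 0 = a ∧
        αs (Fin.last w.length) = c := by
  induction w generalizing a with
  | nil =>
    constructor
    · intro h
      exact ⟨fun _ => a, fun i => i.elim0, rfl, h⟩
    · rintro ⟨αs, -, h0, h1⟩
      exact h0.symm.trans h1
  | cons b w ih =>
    constructor
    · rintro ⟨d, hs, hr⟩
      obtain ⟨αs, h, h0, h1⟩ := (ih d).1 hr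
      refine ⟨Fin.cons (α := fun _ => Q → Bool) a αs, ?_, rfl, h1⟩
      intro i
      refine Fin.cases ?_ (fun j => ?_) i
      · show S a b (αs 0)
        rw [h0]; exact hs
      · exact h j
    · rintro ⟨αs, h, h0, h1⟩
      refine ⟨αs 1, ?_, (ih _).2 ⟨fun i => αs i.succ, fun i => h i.succ, rfl, h1⟩⟩
      rw [← h0]
      exact h (0 : Fin (w.length + 1))

theorem reach_append {ι Q : Type} (S : (Q → Bool) → (ι → Bool) → (Q → Bool) → Prop)
    (w w' : List (ι → Bool)) (a c : Q → Bool) :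
    Reach S (w ++ w') a c ↔ ∃ d, Reach S w a d ∧ Reach S w' d c := by
  induction w generalizing a with
  | nil => simp [Reach]
  | cons b w ih =>
    simp only [List.cons_append, Reach, ih]
    constructor
    · rintro ⟨d, h, e, h1, h2⟩; exact ⟨e, ⟨d, h, h1⟩, h2⟩
    · rintro ⟨e, ⟨d, h, h1⟩, h2⟩; exact ⟨d, h, e, h1, h2⟩

theorem accepts_iff {ι Q : Type} (M : AFA ι Q) (w : List (ι → Bool)) :
    M.Accepts w ↔ ∃ a c, Reach M.Step w a c ∧ M.init.eval a = true ∧ M.final.eval c = true := by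
  constructor
  · rintro ⟨αs, h, hi, hf⟩
    exact ⟨_, _, (reach_iff _ _ _ _).2 ⟨αs, h, rfl, rfl⟩, hi, hf⟩
  · rintro ⟨a, c, h, hi, hf⟩
    obtain ⟨αs, hrun, rfl, rfl⟩ := (reach_iff _ _ _ _).1 h
    exact ⟨αs, hrun, hi, hf⟩

theorem split1_iff {ι : Type} {l : ℕ} (R : AFA ι (Fin l)) (π : Fin l → Bool)
    (w : List (ι → Bool)) :
    (split1 R).AcceptsWith π w ↔ ∃ a c, Reach R.Step w a c ∧ R.init.eval a = true ∧
      ∀ q, c q = true → π q = true := by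
  have key : ∀ c : Fin l → Bool, (split1 R).final.eval (Sum.elim π c) = true ↔
      ∀ q, c q = true → π q = true := by
    intro c
    simp only [split1, eval_bigAnd, List.mem_map, List.mem_finRange, true_and,
      forall_exists_index, forall_apply_eq_imp_iff, BF.eval, Sum.elim_inl, Sum.elim_inr]
    refine forall_congr' fun q => ?_
    cases c q <;> simp
  have key2 : ∀ a : Fin l → Bool, (split1 R).init.eval (Sum.elim π a) = R.init.eval a := by
    intro a; simp [split1, eval_map]
  constructor
  · rintro ⟨αs, h, hi, hf⟩
    rw [key2] at hi
    rw [key] at hf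
    exact ⟨_, _, (reach_iff _ _ _ _).2 ⟨αs, h, rfl, rfl⟩, hi, hf⟩
  · rintro ⟨a, c, h, hi, hf⟩
    obtain ⟨αs, hrun, rfl, rfl⟩ := (reach_iff _ _ _ _).1 h
    exact ⟨αs, hrun, (key2 _).trans hi, (key _).2 hf⟩

theorem split2_iff {ι : Type} {l : ℕ} (R : AFA ι (Fin l)) (π : Fin l → Bool)
    (w : List (ι → Bool)) :
    (split2 R).AcceptsWith π w ↔ ∃ a c, Reach R.Step w a c ∧
      (∀ q, π q = true → a q = true) ∧ R.final.eval c = true := by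
  have key : ∀ c : Fin l → Bool, (split2 R).init.eval (Sum.elim π c) = true ↔
      ∀ q, π q = true → c q = true := by
    intro c
    simp only [split2, eval_bigAnd, List.mem_map, List.mem_finRange, true_and,
      forall_exists_index, forall_apply_eq_imp_iff, BF.eval, Sum.elim_inl, Sum.elim_inr]
    refine forall_congr' fun q => ?_
    cases π q <;> simp
  have key2 : ∀ a : Fin l → Bool, (split2 R).final.eval (Sum.elim π a) = R.final.eval a := by
    intro a; simp [split2, eval_map]
  constructor
  · rintro ⟨αs, h, hi, hf⟩
    rw [key2] at hf
    rw [key] at hi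
    exact ⟨_, _, (reach_iff _ _ _ _).2 ⟨αs, h, rfl, rfl⟩, hi, hf⟩
  · rintro ⟨a, c, h, hi, hf⟩
    obtain ⟨αs, hrun, rfl, rfl⟩ := (reach_iff _ _ _ _).1 h
    exact ⟨αs, hrun, (key _).2 hi, (key2 _).trans hf⟩

theorem reach_anti {ι Q : Type} (M : AFA ι Q) (w : List (ι → Bool)) (a a' c : Q → Bool)
    (haa : ∀ q, a' q = true → a q = true) (h : Reach M.Step w a c) :
    ∃ c', (∀ q, c' q = true → c q = true) ∧ Reach M.Step w a' c' := by
  cases w with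
  | nil =>
    have h' : a = c := h
    exact ⟨a', h' ▸ haa, rfl⟩
  | cons b w =>
    obtain ⟨d, hs, hr⟩ := h
    exact ⟨c, fun _ => id, d, fun q hq => hs q (haa q hq), hr⟩

theorem trackWord_append {V E : Type} [Fintype E] {k : ℕ}
    (w w' : List ((V ⊕ E) × Fin k → Bool)) (i : Fin k) :
    trackWord (w ++ w') i = trackWord w i ++ trackWord w' i := by
  simp [trackWord]

theorem trackWord_split {V E : Type} [Fintype E] {k : ℕ}
    (w : List ((V ⊕ E) × Fin k → Bool)) (i : Fin k) (u v : List (V → Bool))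
    (h : trackWord w i = u ++ v) :
    ∃ w₁ w₂, w = w₁ ++ w₂ ∧ trackWord w₁ i = u ∧ trackWord w₂ i = v := by
  unfold trackWord at h
  obtain ⟨l₁, l₂, h1, h2, h3⟩ := List.map_eq_append_iff.1 h
  obtain ⟨w₁, w₂, h4, h5, h6⟩ := List.filter_eq_append_iff.1 h1
  refine ⟨w₁, w₂, h4, ?_, ?_⟩
  · unfold trackWord; rw [h5, h2]
  · unfold trackWord; rw [h6, h3]

end BSplit

/-- binary splitting is sound: the 2-track AFT `R` accepts the
pair `(x, u ∘ v)` iff there is a split `x = x₁ ∘ x₂` and an assignment of the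
fresh synchronisation parameters `t̄` such that `R₁` accepts `(x₁, u)` and `R₂`
accepts `(x₂, v)` with that assignment; i.e. the constraint `x = R(u ∘ v)` is
equivalent to `∃x₁ x₂ t̄. (x = x₁∘x₂ ∧ x₁ = R₁(u)[t̄] ∧ x₂ = R₂(v)[t̄])`. -/
theorem binary_splitting_sound {V E : Type} [Fintype E] {l : ℕ}
    (R : AFA ((V ⊕ E) × Fin 2) (Fin l)) (hwf : R.WF)
    (x u v : List (V → Bool)) :
    R.RelAccepts ![x, u ++ v] ↔
      ∃ (x₁ x₂ : List (V → Bool)) (π : Fin l → Bool),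
        x = x₁ ++ x₂ ∧ (split1 R).RelAcceptsWith π ![x₁, u] ∧
          (split2 R).RelAcceptsWith π ![x₂, v] := by
  constructor
  · rintro ⟨w, hacc, ht⟩
    have h0 : trackWord w 0 = x := ht 0
    have h1 : trackWord w 1 = u ++ v := ht 1
    obtain ⟨w₁, w₂, rfl, hu, hv⟩ := BSplit.trackWord_split w 1 u v h1
    obtain ⟨a, c, hr, hi, hf⟩ := (BSplit.accepts_iff _ _).1 hacc
    obtain ⟨d, hr1, hr2⟩ := (BSplit.reach_append _ _ _ _ _).1 hr
    refine ⟨trackWord w₁ 0, trackWord w₂ 0, d, ?_, ⟨w₁, ?_, ?_⟩, ⟨w₂, ?_, ?_⟩⟩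
    · rw [← h0, BSplit.trackWord_append]
    · exact (BSplit.split1_iff _ _ _).2 ⟨a, d, hr1, hi, fun _ => id⟩
    · exact Fin.forall_fin_two.2 ⟨rfl, hu⟩
    · exact (BSplit.split2_iff _ _ _).2 ⟨d, c, hr2, fun _ => id, hf⟩
    · exact Fin.forall_fin_two.2 ⟨rfl, hv⟩
  · rintro ⟨x₁, x₂, π, rfl, ⟨w₁, hacc1, ht1⟩, ⟨w₂, hacc2, ht2⟩⟩
    obtain ⟨a, d, hr1, hi, hd⟩ := (BSplit.split1_iff _ _ _).1 hacc1
    obtain ⟨d', c, hr2, hd', hf⟩ := (BSplit.split2_iff _ _ _).1 hacc2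
    obtain ⟨c', hc, hr2'⟩ := BSplit.reach_anti R w₂ d' d c (fun q hq => hd' q (hd q hq)) hr2
    refine ⟨w₁ ++ w₂, (BSplit.accepts_iff _ _).2 ⟨a, c', ?_, hi, ?_⟩, ?_⟩
    · exact (BSplit.reach_append _ _ _ _ _).2 ⟨d, hr1, hr2'⟩
    · exact (BSplit.eval_mono c' c hc R.final).2 hwf.2.2 hf
    · have e10 : trackWord w₁ 0 = x₁ := ht1 0
      have e11 : trackWord w₁ 1 = u := ht1 1
      have e20 : trackWord w₂ 0 = x₂ := ht2 0
      have e21 : trackWord w₂ 1 = v := ht2 1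
      refine Fin.forall_fin_two.2 ⟨?_, ?_⟩
      · rw [BSplit.trackWord_append, e10, e20]; rfl
      · rw [BSplit.trackWord_append, e11, e21]; rfl
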